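/- Let A and O be nonempty finite sets, let R : O → [0,1], and let M be a nonempty convex class of models, where a model M assigns to each a ∈ A a probability distribution M(a) on O; write f_M(a) = E_{o∼M(a)}[R(o)] and let a_M be a maximizer of f_M over A. Fix a probability distribution w on A and γ > 0. For probability distributions p, q on A and a function ξ : A × A × O → ℝ, define Γ_{w,γ}(p, q, ξ; M, a*) = E_{a∼p}[f_M(a*) − f_M(a)] − γ·E_{a∼q} E_{o∼M(a)} E_{a'∼w}[ 1 − exp( ξ(a'; a, o) − ξ(a*; a, o) ) ], and Γ_{w,γ}(p, q, ξ) = sup over M ∈ M and a* ∈ A of Γ_{w,γ}(p, q, ξ; M, a*). Then the infimum over probability distributions p, q on A and functions ξ : A × A × O → ℝ of Γ_{w,γ}(p, q, ξ) is at most p-dec_{γ/8}(M), where p-dec_η(M) = sup over M̄ ∈ M of the infimum over probability distributions p, q on A of the supremum over M ∈ M of ( E_{a∼p}[f_M(a_M) − f_M(a)] − η·E_{a∼q}[H²(M(a), M̄(a))] ). -/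

import Mathlib

/-- Probability distributions on a finite set `A`. -/
def ProbVec (A : Type*) [Fintype A] : Type _ :=
  {p : A → ℝ // (∀ a, 0 ≤ p a) ∧ ∑ a, p a = 1}

/-- Squared Hellinger distance between probability distributions on a finite set:
`H²(P,Q) = ½ ∑_o (√P(o) − √Q(o))²`. -/
noncomputable def sqHellingerFin {O : Type*} [Fintype O] (P Q : O → ℝ) : ℝ :=
  (1 / 2) * ∑ o, (Real.sqrt (P o) - Real.sqrt (Q o)) ^ 2

/-- Mean reward `f_M(a) = E_{o∼M(a)}[R(o)]` of action `a` under model `M`. -/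
noncomputable def fVal {A O : Type*} [Fintype O] (R : O → ℝ) (M : A → O → ℝ) (a : A) : ℝ :=
  ∑ o, M a o * R o

/-- The exploration-by-optimization objective
`Γ_{w,γ}(p,q,ξ; M, a*) = E_{a∼p}[f_M(a*) − f_M(a)]
  − γ E_{a∼q} E_{o∼M(a)} E_{a'∼w}[1 − exp(ξ(a';a,o) − ξ(a*;a,o))]`. -/
noncomputable def exoObj {A O : Type*} [Fintype A] [Fintype O] (R : O → ℝ) (γ : ℝ)
    (w p q : A → ℝ) (ξ : A → A → O → ℝ) (M : A → O → ℝ) (astar : A) : ℝ :=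
  (∑ a, p a * (fVal R M astar - fVal R M a))
    - γ * ∑ a, q a * ∑ o, M a o *
        ∑ a', w a' * (1 - Real.exp (ξ a' a o - ξ astar a o))

lemma mul_exp_weighted_le {ι : Type*} [Fintype ι] (c x : ι → ℝ) (hc : ∀ j, 0 ≤ c j) :
    (∑ j, c j) * Real.exp (∑ j, c j / (∑ k, c k) * x j) ≤ ∑ j, c j * Real.exp (x j) := by
  rcases (Finset.sum_nonneg fun j _ => hc j : 0 ≤ ∑ j, c j).eq_or_lt with h | h
  · rw [← h, zero_mul]
    exact Finset.sum_nonneg fun j _ => mul_nonneg (hc j) (Real.exp_pos _).le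
  · have key := convexOn_exp.map_sum_le (t := Finset.univ) (w := fun j => c j / ∑ k, c k) (p := x)
      (fun j _ => div_nonneg (hc j) h.le)
      (by rw [← Finset.sum_div, div_self h.ne']) (fun _ _ => Set.mem_univ _)
    simp only [smul_eq_mul] at key
    calc (∑ j, c j) * Real.exp (∑ j, c j / (∑ k, c k) * x j)
        ≤ (∑ j, c j) * ∑ j, c j / (∑ k, c k) * Real.exp (x j) :=
          mul_le_mul_of_nonneg_left key h.le
      _ = ∑ j, c j * Real.exp (x j) := by
          rw [Finset.mul_sum]
          refine Finset.sum_congr rfl fun j _ => ?_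
          field_simp

/-- The finite-dimensional minimax step: if no point of a convex set dominates the level `c`
in every coordinate, some convex combination of the coordinates is at most `c` on the set. -/
lemma exists_weights_sum_le {ι : Type*} [Fintype ι] {S : Set (ι → ℝ)} (hS : Convex ℝ S)
    (hne : S.Nonempty) (c : ℝ) (h : ∀ s ∈ S, ∃ j, s j ≤ c) :
    ∃ l : ι → ℝ, (∀ j, 0 ≤ l j) ∧ ∑ j, l j = 1 ∧ ∀ s ∈ S, ∑ j, l j * s j ≤ c := by
  classical
  have hTeq : {y : ι → ℝ | ∀ j, c < y j} = Set.univ.pi fun _ => Set.Ioi c := by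
    ext y; simp [Set.mem_pi]
  have hTo : IsOpen {y : ι → ℝ | ∀ j, c < y j} := by
    rw [hTeq]; exact isOpen_set_pi Set.finite_univ fun _ _ => isOpen_Ioi
  have hTc : Convex ℝ {y : ι → ℝ | ∀ j, c < y j} := by
    rw [hTeq]; exact convex_pi fun _ _ => convex_Ioi c
  have hdis : Disjoint {y : ι → ℝ | ∀ j, c < y j} S := by
    rw [Set.disjoint_left]
    intro y hy hyS
    obtain ⟨j, hj⟩ := h y hyS
    exact absurd (hy j) (not_lt.mpr hj)
  obtain ⟨f, u, hfT, hfS⟩ := geometric_hahn_banach_open hTc hTo hS hdis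
  set b : ι → ℝ := fun j => -f (Pi.single j 1) with hb
  have hf : ∀ y : ι → ℝ, f y = -∑ j, b j * y j := by
    intro y
    have hy : y = ∑ j, y j • (Pi.single j (1 : ℝ) : ι → ℝ) := by
      ext k; simp [Finset.sum_apply, Pi.single_apply]
    conv_lhs => rw [hy]
    simp [map_sum, hb, mul_comm]
  have hT1 : ∀ j, ∀ r : ℝ, 0 ≤ r → -(∑ k, b k * (c + 1)) - r * b j < u := by
    intro j r hr
    have := hfT (fun k => (c + 1) + if k = j then r else 0) (fun k => by
      show c < (c + 1) + if k = j then r else 0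
      split_ifs <;> linarith)
    rw [hf] at this
    simp only [mul_add, Finset.sum_add_distrib, mul_ite, mul_zero, Finset.sum_ite_eq',
      Finset.mem_univ, if_true] at this ⊢
    linarith
  have hb0 : ∀ j, 0 ≤ b j := by
    intro j
    by_contra! hneg
    have h0 := hT1 j 0 le_rfl
    have h1 := hT1 j ((u + ∑ k, b k * (c + 1)) / (-b j))
      (div_nonneg (by linarith) (by linarith))
    have h2 : (u + ∑ k, b k * (c + 1)) / (-b j) * b j = -(u + ∑ k, b k * (c + 1)) := by
      rw [div_neg, neg_mul, div_mul_cancel₀ _ hneg.ne]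
    linarith
  have hTe : ∀ e : ℝ, 0 < e → -((∑ j, b j) * (c + e)) < u := by
    intro e he
    have := hfT (fun _ => c + e) (fun k => by show c < c + e; linarith)
    rwa [hf, ← Finset.sum_mul] at this
  have hBpos : 0 < ∑ j, b j := by
    refine (Finset.sum_nonneg fun j _ => hb0 j).lt_of_ne fun h0 => ?_
    obtain ⟨s, hs⟩ := hne
    have h1 := hTe 1 one_pos
    have h2 := hfS s hs
    have hz : ∀ j, b j = 0 := fun j =>
      (Finset.sum_eq_zero_iff_of_nonneg fun j _ => hb0 j).1 h0.symm j (Finset.mem_univ j)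
    rw [hf] at h2
    simp only [hz, zero_mul, Finset.sum_const_zero, neg_zero] at h1 h2
    linarith
  refine ⟨fun j => b j / ∑ k, b k, fun j => div_nonneg (hb0 j) hBpos.le,
    by rw [← Finset.sum_div, div_self hBpos.ne'], fun s hs => ?_⟩
  have h2 := hfS s hs
  rw [hf] at h2
  simp only [div_mul_eq_mul_div]
  rw [← Finset.sum_div, div_le_iff₀ hBpos]
  refine le_of_forall_pos_le_add fun e he => ?_
  have h1 := hTe (e / ∑ k, b k) (div_pos he hBpos)
  rw [mul_add, mul_div_cancel₀ _ hBpos.ne'] at h1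
  linarith

lemma sq_sum_sqrt_mul_le {A : Type*} [Fintype A] {w m : A → ℝ} (hw : ∀ i, 0 ≤ w i)
    (hw1 : ∑ i, w i = 1) (hm : ∀ i, 0 ≤ m i) :
    (∑ i, √(w i * m i)) ^ 2 ≤ ∑ i, m i := by
  have h := Real.sum_sqrt_mul_sqrt_le Finset.univ hw hm
  simp only [← Real.sqrt_mul (hw _)] at h
  rw [hw1, Real.sqrt_one, one_mul] at h
  calc (∑ i, √(w i * m i)) ^ 2 ≤ (√(∑ i, m i)) ^ 2 :=
        pow_le_pow_left₀ (Finset.sum_nonneg fun _ _ => Real.sqrt_nonneg _) h 2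
    _ = ∑ i, m i := Real.sq_sqrt (Finset.sum_nonneg fun i _ => hm i)

/-- The expected squared Hellinger distance of the components of a mixture to the mixture is
controlled by the optimal value of the estimation term of exploration-by-optimization. -/
lemma sum_mul_sqHellingerFin_le {A O : Type*} [Fintype A] [Fintype O] {w ν : A → ℝ}
    {P : A → O → ℝ} (hw : ∀ i, 0 ≤ w i) (hw1 : ∑ i, w i = 1)
    (hν : ∀ i, 0 ≤ ν i) (hν1 : ∑ i, ν i = 1)
    (hP : ∀ i o, 0 ≤ P i o) (hP1 : ∀ i, ∑ o, P i o = 1) :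
    ∑ i, ν i * sqHellingerFin (P i) (fun o => ∑ k, ν k * P k o) ≤
      4 * ∑ o, (∑ i, ν i * P i o - (∑ i, √(w i * (ν i * P i o))) ^ 2) := by
  set B : O → ℝ := fun o => ∑ k, ν k * P k o with hB
  have hm : ∀ i o, 0 ≤ ν i * P i o := fun i o => mul_nonneg (hν i) (hP i o)
  have hB0 : ∀ o, 0 ≤ B o := fun o => Finset.sum_nonneg fun i _ => hm i o
  have hB1 : ∑ o, B o = 1 := by
    simp only [hB]
    rw [Finset.sum_comm]
    simp only [← Finset.mul_sum, hP1, mul_one, hν1]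
  set D : ℝ := ∑ o, ∑ i, (√(ν i * P i o) - √(w i) * √(B o)) ^ 2 with hD
  set C : ℝ := ∑ o, √(B o) * ∑ i, √(w i) * √(ν i * P i o) with hC
  have hDC : D = 2 - 2 * C := by
    have : ∀ o, ∑ i, (√(ν i * P i o) - √(w i) * √(B o)) ^ 2
        = 2 * B o - 2 * (√(B o) * ∑ i, √(w i) * √(ν i * P i o)) := by
      intro o
      have e : ∀ i, (√(ν i * P i o) - √(w i) * √(B o)) ^ 2
          = ν i * P i o + w i * B o - 2 * (√(B o) * (√(w i) * √(ν i * P i o))) := by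
        intro i
        have h1 := Real.sq_sqrt (hm i o)
        have h2 := Real.sq_sqrt (hw i)
        have h3 := Real.sq_sqrt (hB0 o)
        rw [sub_sq, mul_pow, h1, h2, h3]; ring
      simp only [e, Finset.sum_sub_distrib, Finset.sum_add_distrib, ← Finset.sum_mul,
        ← Finset.mul_sum, hw1]
      show B o + _ - _ = _
      ring
    rw [hD]
    simp only [this, Finset.sum_sub_distrib, ← Finset.mul_sum, hB1, hC, mul_one]
  have hleft : ∑ i, ν i * sqHellingerFin (P i) B
      = 1 / 2 * ∑ o, ∑ i, (√(ν i * P i o) - √(ν i) * √(B o)) ^ 2 := by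
    unfold sqHellingerFin
    rw [Finset.sum_comm, Finset.mul_sum]
    refine Finset.sum_congr rfl fun i _ => ?_
    rw [Finset.mul_sum, Finset.mul_sum, Finset.mul_sum]
    refine Finset.sum_congr rfl fun o _ => ?_
    rw [Real.sqrt_mul (hν i), ← mul_sub, mul_pow, Real.sq_sqrt (hν i)]; ring
  have hmarg : ∑ i, (√(w i) - √(ν i)) ^ 2 ≤ D := by
    have e : ∑ i, (√(w i) - √(ν i)) ^ 2 = 2 - 2 * ∑ i, √(w i) * √(ν i) := by
      have e : ∀ i, (√(w i) - √(ν i)) ^ 2 = w i + ν i - 2 * (√(w i) * √(ν i)) := by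
        intro i; rw [sub_sq, Real.sq_sqrt (hw i), Real.sq_sqrt (hν i)]; ring
      simp only [e, Finset.sum_sub_distrib, Finset.sum_add_distrib, ← Finset.mul_sum, hw1, hν1]
      norm_num
    have hCle : C ≤ ∑ i, √(w i) * √(ν i) := by
      rw [hC]
      simp only [Finset.mul_sum]
      rw [Finset.sum_comm]
      refine Finset.sum_le_sum fun i _ => ?_
      have h := Real.sum_sqrt_mul_sqrt_le Finset.univ hB0 (hm i)
      rw [hB1, ← Finset.mul_sum, hP1, Real.sqrt_one, one_mul, mul_one] at h
      calc ∑ o, √(B o) * (√(w i) * √(ν i * P i o))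
          = √(w i) * ∑ o, √(B o) * √(ν i * P i o) := by
            rw [Finset.mul_sum]; exact Finset.sum_congr rfl fun o _ => by ring
        _ ≤ _ := mul_le_mul_of_nonneg_left h (Real.sqrt_nonneg _)
    rw [e, hDC]; linarith
  have htri : ∑ o, ∑ i, (√(ν i * P i o) - √(ν i) * √(B o)) ^ 2 ≤ 4 * D := by
    have h1 : ∑ o, ∑ i, (√(ν i * P i o) - √(ν i) * √(B o)) ^ 2
        ≤ ∑ o, ∑ i, (2 * (√(ν i * P i o) - √(w i) * √(B o)) ^ 2
          + 2 * (B o * (√(w i) - √(ν i)) ^ 2)) := by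
      refine Finset.sum_le_sum fun o _ => Finset.sum_le_sum fun i _ => ?_
      have h3 := Real.sq_sqrt (hB0 o)
      have h4 : B o * (√(w i) - √(ν i)) ^ 2 = (√(w i) * √(B o) - √(ν i) * √(B o)) ^ 2 := by
        rw [← sub_mul, mul_pow, h3]; ring
      rw [h4]
      nlinarith [sq_nonneg ((√(ν i * P i o) - √(w i) * √(B o))
        - (√(w i) * √(B o) - √(ν i) * √(B o)))]
    have h2 : ∑ o, ∑ i, (2 * (√(ν i * P i o) - √(w i) * √(B o)) ^ 2
          + 2 * (B o * (√(w i) - √(ν i)) ^ 2)) = 2 * D + 2 * ∑ i, (√(w i) - √(ν i)) ^ 2 := by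
      simp only [Finset.sum_add_distrib, ← Finset.mul_sum, ← Finset.sum_mul, hB1, one_mul, hD]
    linarith
  have hright : 1 / 2 * D ≤ ∑ o, (B o - (∑ i, √(w i * (ν i * P i o))) ^ 2) := by
    rw [Finset.sum_sub_distrib, hB1, hDC]
    have : ∑ o, (∑ i, √(w i * (ν i * P i o))) ^ 2 ≤ C := by
      rw [hC]
      refine Finset.sum_le_sum fun o _ => ?_
      simp only [Real.sqrt_mul (hw _)]
      have h := sq_sum_sqrt_mul_le hw hw1 (fun i => hm i o)
      simp only [Real.sqrt_mul (hw _)] at h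
      have h' := Real.abs_le_sqrt h
      rw [sq]
      exact mul_le_mul_of_nonneg_right ((le_abs_self _).trans h')
        (Finset.sum_nonneg fun i _ => by positivity)
    linarith
  rw [hleft]
  linarith

lemma exists_sum_mul_exp_sub_le {A : Type*} [Fintype A] {w m : A → ℝ} (hw : ∀ i, 0 ≤ w i)
    (hm : ∀ i, 0 ≤ m i) {ε : ℝ} (hε : 0 < ε) :
    ∃ x : A → ℝ, ∑ i, m i * ∑ k, w k * Real.exp (x k - x i) ≤ (∑ i, √(w i * m i)) ^ 2 + ε := by
  have hcont : Continuous fun e : ℝ =>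
      (∑ k, √(w k * (m k + e))) * ∑ i, √(m i * (w i + e)) := by fun_prop
  have h0 : (∑ k, √(w k * (m k + 0))) * ∑ i, √(m i * (w i + 0))
      < (∑ i, √(w i * m i)) ^ 2 + ε := by
    simp only [add_zero, mul_comm (m _) (w _)]
    rw [← sq]; linarith
  obtain ⟨e, he, hepos⟩ := ((hcont.continuousAt.eventually_lt continuousAt_const h0).filter_mono
    (nhdsWithin_le_nhds (s := Set.Ioi 0)) |>.and self_mem_nhdsWithin).exists
  have hepos : 0 < e := hepos
  have aux : ∀ u v : ℝ, 0 ≤ u → 0 ≤ v → u * √((v + e) / (u + e)) ≤ √(u * (v + e)) := by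
    intro u v hu hv
    calc u * √((v + e) / (u + e)) = √(u ^ 2 * ((v + e) / (u + e))) := by
          rw [Real.sqrt_mul (sq_nonneg u), Real.sqrt_sq hu]
      _ ≤ √(u * (v + e)) := by
          apply Real.sqrt_le_sqrt
          rw [mul_div_assoc', div_le_iff₀ (by positivity)]
          nlinarith [mul_nonneg (mul_nonneg hu hepos.le) (add_nonneg hv hepos.le)]
  have hpos : ∀ i, 0 < √((m i + e) / (w i + e)) := fun i =>
    Real.sqrt_pos.2 (div_pos (by linarith [hm i]) (by linarith [hw i]))
  refine ⟨fun i => Real.log √((m i + e) / (w i + e)), le_trans (le_of_eq ?_)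
    (le_trans (mul_le_mul (Finset.sum_le_sum fun k _ => aux (w k) (m k) (hw k) (hm k))
      (Finset.sum_le_sum fun i _ => aux (m i) (w i) (hm i) (hw i))
      (Finset.sum_nonneg fun i _ => mul_nonneg (hm i) (Real.sqrt_nonneg _))
      (Finset.sum_nonneg fun i _ => Real.sqrt_nonneg _)) he.le)⟩
  rw [mul_comm, Finset.sum_mul]
  refine Finset.sum_congr rfl fun i _ => ?_
  rw [mul_assoc]
  congr 1
  rw [Finset.mul_sum]
  refine Finset.sum_congr rfl fun k _ => ?_
  rw [Real.exp_sub, Real.exp_log (hpos k), Real.exp_log (hpos i), ← inv_div (m i + e) (w i + e),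
    Real.sqrt_inv]
  field_simp

lemma exists_le_sum_mul {A : Type*} [Fintype A] (p : ProbVec A) (r : A → ℝ) :
    ∃ a, r a ≤ ∑ i, p.1 i * r i := by
  by_contra! h
  obtain ⟨hp, hp1⟩ := p.2
  have h1 : ∑ i, p.1 i * (r i - ∑ k, p.1 k * r k) = 0 := by
    simp only [mul_sub, Finset.sum_sub_distrib, ← Finset.sum_mul, hp1, one_mul, sub_self]
  have h2 := (Finset.sum_eq_zero_iff_of_nonneg fun i _ =>
    mul_nonneg (hp i) (sub_nonneg.2 (h i).le)).1 h1
  have h3 : ∀ i, p.1 i = 0 := fun i =>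
    (mul_eq_zero.1 (h2 i (Finset.mem_univ i))).resolve_right (sub_pos.2 (h i)).ne'
  simp [h3] at hp1

/-- Total regret of action `a` against the comparators, for a family `N` of (unnormalized) models
indexed by the comparator. -/
noncomputable def totalRegret {A O : Type*} [Fintype A] [Fintype O] (R : O → ℝ)
    (N : A → A → O → ℝ) (a : A) : ℝ :=
  ∑ i, (fVal R (N i) i - fVal R (N i) a)

/-- Optimal value over `ξ` of the estimation term of exploration-by-optimization at action `b`. -/
noncomputable def infoGap {A O : Type*} [Fintype A] [Fintype O] (w : A → ℝ)
    (N : A → A → O → ℝ) (b : A) : ℝ :=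
  ∑ o, (∑ i, N i b o - (∑ i, √(w i * N i b o)) ^ 2)

lemma fVal_smul {A O : Type*} [Fintype O] (R : O → ℝ) (t : ℝ) (M : A → O → ℝ) (a : A) :
    fVal R (fun a o => t * M a o) a = t * fVal R M a := by
  simp only [fVal, Finset.mul_sum, mul_assoc]

lemma exists_totalRegret_sub_infoGap_le {A O : Type*} [Fintype A] [Fintype O] {R : O → ℝ}
    {γ c : ℝ} (hγ : 0 < γ) (w p q ν : ProbVec A) {M : A → A → O → ℝ}
    (hM : ∀ i a, (∀ o, 0 ≤ M i a o) ∧ ∑ o, M i a o = 1)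
    (h : ∀ i, ∑ a, p.1 a * (fVal R (M i) i - fVal R (M i) a)
      - γ / 8 * ∑ a, q.1 a * sqHellingerFin (M i a) (fun o => ∑ k, ν.1 k * M k a o) ≤ c) :
    ∃ a b, totalRegret R (fun i a o => ν.1 i * M i a o) a
      - γ * infoGap w.1 (fun i a o => ν.1 i * M i a o) b ≤ c := by
  set N : A → A → O → ℝ := fun i a o => ν.1 i * M i a o with hN
  obtain ⟨a, ha⟩ := exists_le_sum_mul p (totalRegret R N)
  obtain ⟨b, hb⟩ := exists_le_sum_mul q (fun b => - infoGap w.1 N b)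
  refine ⟨a, b, ?_⟩
  have hgap : ∀ a, ∑ i, ν.1 i * sqHellingerFin (M i a) (fun o => ∑ k, ν.1 k * M k a o)
      ≤ 4 * infoGap w.1 N a := fun a =>
    sum_mul_sqHellingerFin_le w.2.1 w.2.2 ν.2.1 ν.2.2 (fun i => (hM i a).1) (fun i => (hM i a).2)
  have hgap0 : ∀ a, 0 ≤ infoGap w.1 N a := fun a => Finset.sum_nonneg fun o _ =>
    sub_nonneg.2 (sq_sum_sqrt_mul_le w.2.1 w.2.2 fun i => mul_nonneg (ν.2.1 i) ((hM i a).1 o))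
  have hreg : ∑ a, p.1 a * totalRegret R N a
      = ∑ i, ν.1 i * ∑ a, p.1 a * (fVal R (M i) i - fVal R (M i) a) := by
    simp only [totalRegret, hN, fVal_smul, Finset.mul_sum]
    rw [Finset.sum_comm]
    exact Finset.sum_congr rfl fun i _ => Finset.sum_congr rfl fun a _ => by ring
  have hle : ∑ i, ν.1 i * ∑ a, p.1 a * (fVal R (M i) i - fVal R (M i) a)
      ≤ ∑ i, ν.1 i * (c + γ / 8 *
        ∑ a, q.1 a * sqHellingerFin (M i a) (fun o => ∑ k, ν.1 k * M k a o)) :=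
    Finset.sum_le_sum fun i _ => mul_le_mul_of_nonneg_left (by linarith [h i]) (ν.2.1 i)
  have hexp : ∑ i, ν.1 i * (c + γ / 8 *
        ∑ a, q.1 a * sqHellingerFin (M i a) (fun o => ∑ k, ν.1 k * M k a o))
      = c + γ / 8 * ∑ a, q.1 a *
        ∑ i, ν.1 i * sqHellingerFin (M i a) (fun o => ∑ k, ν.1 k * M k a o) := by
    simp only [mul_add, Finset.sum_add_distrib, ← Finset.sum_mul, ν.2.2, one_mul]
    congr 1
    simp only [Finset.mul_sum]
    rw [Finset.sum_comm]
    exact Finset.sum_congr rfl fun i _ => Finset.sum_congr rfl fun a _ => by ring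
  have h4 : ∑ a, q.1 a * ∑ i, ν.1 i * sqHellingerFin (M i a) (fun o => ∑ k, ν.1 k * M k a o)
      ≤ ∑ a, q.1 a * (4 * infoGap w.1 N a) :=
    Finset.sum_le_sum fun a _ => mul_le_mul_of_nonneg_left (hgap a) (q.2.1 a)
  have h5 : ∑ a, q.1 a * (4 * infoGap w.1 N a) = 4 * ∑ a, q.1 a * infoGap w.1 N a := by
    rw [Finset.mul_sum]; exact Finset.sum_congr rfl fun a _ => by ring
  have h6 : 0 ≤ ∑ a, q.1 a * infoGap w.1 N a :=
    Finset.sum_nonneg fun a _ => mul_nonneg (q.2.1 a) (hgap0 a)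
  simp only [mul_neg, Finset.sum_neg_distrib] at hb
  have hb' : ∑ a, q.1 a * infoGap w.1 N a ≤ infoGap w.1 N b := by linarith
  nlinarith

lemma exists_sum_exoObj_lt {A O : Type*} [Fintype A] [DecidableEq A] [Fintype O] {R : O → ℝ}
    {γ c : ℝ} (hγ : 0 < γ) (w : ProbVec A) {N : A → A → O → ℝ} (hN : ∀ i a o, 0 ≤ N i a o)
    {a b : A} (h : totalRegret R N a - γ * infoGap w.1 N b < c) :
    ∃ ξ, ∑ i, exoObj R γ w.1 (Pi.single a 1) (Pi.single b 1) ξ (N i) i < c := by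
  set δ := c - (totalRegret R N a - γ * infoGap w.1 N b) with hδ
  have hδ0 : 0 < δ := by linarith
  set ε := δ / (γ * (Fintype.card O + 1)) with hε
  have hε0 : 0 < ε := by positivity
  choose x hx using fun o => exists_sum_mul_exp_sub_le w.2.1 (fun i => hN i b o) hε0
  refine ⟨fun i _ o => x o i, ?_⟩
  have e : ∑ i, exoObj R γ w.1 (Pi.single a 1) (Pi.single b 1) (fun i _ o => x o i) (N i) i
      = totalRegret R N a - γ * ∑ o, (∑ i, N i b o
        - ∑ i, N i b o * ∑ k, w.1 k * Real.exp (x o k - x o i)) := by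
    simp only [exoObj, totalRegret, Finset.sum_sub_distrib, ← Finset.mul_sum, Pi.single_apply,
      ite_mul, one_mul, zero_mul, Finset.sum_ite_eq', Finset.mem_univ, if_true, mul_sub, w.2.2,
      mul_one]
    rw [Finset.sum_comm, Finset.sum_comm (f := fun i o => N i b o * _)]
  have hs : infoGap w.1 N b - Fintype.card O * ε ≤ ∑ o, (∑ i, N i b o
        - ∑ i, N i b o * ∑ k, w.1 k * Real.exp (x o k - x o i)) := by
    have : (Fintype.card O : ℝ) * ε = ∑ _o : O, ε := by simp
    rw [infoGap, this, ← Finset.sum_sub_distrib]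
    exact Finset.sum_le_sum fun o _ => by linarith [hx o]
  have hlt : γ * (Fintype.card O * ε) < δ := by
    have : γ * ((Fintype.card O + 1) * ε) = δ := by rw [hε]; field_simp
    nlinarith [mul_pos hγ hε0]
  rw [e]
  nlinarith [mul_le_mul_of_nonneg_left hs hγ.le]

lemma exoObj_eq_sum {A O : Type*} [Fintype A] [Fintype O] (R : O → ℝ) (γ : ℝ)
    (w p q : A → ℝ) (ξ : A → A → O → ℝ) (M : A → O → ℝ) (i : A) :
    exoObj R γ w p q ξ M i = ∑ a, (p a * (fVal R M i - fVal R M a) -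
      ∑ o, ∑ k, γ * (M a o * w k) * (q a - q a * Real.exp (ξ k a o - ξ i a o))) := by
  rw [exoObj, Finset.mul_sum, ← Finset.sum_sub_distrib]
  refine Finset.sum_congr rfl fun a _ => ?_
  simp only [Finset.mul_sum]
  congr 1
  exact Finset.sum_congr rfl fun o _ => Finset.sum_congr rfl fun k _ => by ring

/-- Joint convexity of the objective in `(p, q, ξ)` after the change of variables `g = q ξ`. -/
lemma exists_exoObj_le_sum {A O ι : Type*} [Fintype A] [Fintype O] [Fintype ι] (R : O → ℝ)
    {γ : ℝ} (hγ : 0 < γ) (w : ProbVec A) (p q : ι → ProbVec A) (ξ : ι → A → A → O → ℝ)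
    {l : ι → ℝ} (hl : ∀ j, 0 ≤ l j) (hl1 : ∑ j, l j = 1) :
    ∃ (p' q' : ProbVec A) (ξ' : A → A → O → ℝ), ∀ M : A → O → ℝ, (∀ a o, 0 ≤ M a o) → ∀ i,
      exoObj R γ w.1 p'.1 q'.1 ξ' M i
        ≤ ∑ j, l j * exoObj R γ w.1 (p j).1 (q j).1 (ξ j) M i := by
  have mix : ∀ r : ι → ProbVec A, (∀ a, 0 ≤ ∑ j, l j * (r j).1 a) ∧
      ∑ a, ∑ j, l j * (r j).1 a = 1 := by
    refine fun r => ⟨fun a => Finset.sum_nonneg fun j _ => mul_nonneg (hl j) ((r j).2.1 a), ?_⟩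
    rw [Finset.sum_comm]
    simp only [← Finset.mul_sum, (r _).2.2, mul_one, hl1]
  refine ⟨⟨_, mix p⟩, ⟨_, mix q⟩,
    fun k a o => ∑ j, l j * (q j).1 a / (∑ j, l j * (q j).1 a) * ξ j k a o, fun M hM i => ?_⟩
  simp only [exoObj_eq_sum]
  have e : ∑ j, l j * ∑ a, ((p j).1 a * (fVal R M i - fVal R M a) -
        ∑ o, ∑ k, γ * (M a o * w.1 k) *
          ((q j).1 a - (q j).1 a * Real.exp (ξ j k a o - ξ j i a o)))
      = ∑ a, ((∑ j, l j * (p j).1 a) * (fVal R M i - fVal R M a) -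
        ∑ o, ∑ k, γ * (M a o * w.1 k) *
          ∑ j, l j * ((q j).1 a - (q j).1 a * Real.exp (ξ j k a o - ξ j i a o))) := by
    simp only [Finset.mul_sum, mul_sub (l _) _ (∑ o, _)]
    rw [Finset.sum_comm]
    refine Finset.sum_congr rfl fun a _ => ?_
    rw [Finset.sum_sub_distrib, Finset.sum_mul]
    congr 1
    · exact Finset.sum_congr rfl fun j _ => by ring
    · rw [Finset.sum_comm]
      refine Finset.sum_congr rfl fun o _ => ?_
      rw [Finset.sum_comm]
      exact Finset.sum_congr rfl fun k _ => Finset.sum_congr rfl fun j _ => by ring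
  rw [e]
  refine Finset.sum_le_sum fun a _ => sub_le_sub le_rfl <| Finset.sum_le_sum fun o _ =>
    Finset.sum_le_sum fun k _ => mul_le_mul_of_nonneg_left ?_
      (mul_nonneg hγ.le (mul_nonneg (hM a o) (w.2.1 k)))
  have key := mul_exp_weighted_le (fun j => l j * (q j).1 a)
    (fun j => ξ j k a o - ξ j i a o) fun j => mul_nonneg (hl j) ((q j).2.1 a)
  simp only [mul_sub, Finset.sum_sub_distrib] at key ⊢
  simp only [mul_assoc] at key ⊢
  linarith

/-- Unnormalized families `(ν i • M i)_i` with `ν` a distribution and all `M i` in the class. -/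
def weightedFamilies {A O : Type*} [Fintype A] (𝓜 : Set (A → O → ℝ)) : Set (A → A → O → ℝ) :=
  {N | ∃ (ν : ProbVec A) (M : A → A → O → ℝ), (∀ i, M i ∈ 𝓜) ∧ N = fun i a o => ν.1 i * M i a o}

lemma convex_of_mix_mem {A O : Type*} {𝓜 : Set (A → O → ℝ)}
    (h𝓜conv : ∀ M ∈ 𝓜, ∀ M' ∈ 𝓜, ∀ t : ℝ, 0 ≤ t → t ≤ 1 →
      (fun a o => t * M a o + (1 - t) * M' a o) ∈ 𝓜) : Convex ℝ 𝓜 := by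
  intro M hM M' hM' s t hs ht hst
  have h := h𝓜conv M hM M' hM' s hs (by linarith)
  obtain rfl : t = 1 - s := by linarith
  exact h

lemma convex_weightedFamilies {A O : Type*} [Fintype A] {𝓜 : Set (A → O → ℝ)}
    (h : Convex ℝ 𝓜) : Convex ℝ (weightedFamilies 𝓜) := by
  rintro _ ⟨ν, M, hM, rfl⟩ _ ⟨ν', M', hM', rfl⟩ s t hs ht hst
  have h0 : ∀ i, 0 ≤ s * ν.1 i := fun i => mul_nonneg hs (ν.2.1 i)
  have h0' : ∀ i, 0 ≤ t * ν'.1 i := fun i => mul_nonneg ht (ν'.2.1 i)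
  have key : ∀ i, ∃ M'' ∈ 𝓜, ∀ a o, s * (ν.1 i * M i a o) + t * (ν'.1 i * M' i a o)
      = (s * ν.1 i + t * ν'.1 i) * M'' a o := by
    intro i
    rcases (add_nonneg (h0 i) (h0' i)).eq_or_lt with hz | hpos
    · refine ⟨M i, hM i, fun a o => ?_⟩
      have h1 : s * ν.1 i = 0 := by linarith [h0 i, h0' i]
      have h2 : t * ν'.1 i = 0 := by linarith [h0 i, h0' i]
      rw [← mul_assoc, ← mul_assoc, h1, h2]; ring
    · refine ⟨_, h (hM i) (hM' i) (div_nonneg (h0 i) hpos.le) (div_nonneg (h0' i) hpos.le)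
        (by rw [← add_div, div_self hpos.ne']), fun a o => ?_⟩
      simp only [Pi.add_apply, Pi.smul_apply, smul_eq_mul]
      field_simp
  choose M'' hM'' he using key
  refine ⟨⟨fun i => s * ν.1 i + t * ν'.1 i, fun i => add_nonneg (h0 i) (h0' i), ?_⟩, M'', hM'', ?_⟩
  · rw [Finset.sum_add_distrib, ← Finset.mul_sum, ← Finset.mul_sum, ν.2.2, ν'.2.2]; linarith
  · ext i a o
    exact he i a o

lemma exoObj_add_mul {A O : Type*} [Fintype A] [Fintype O] (R : O → ℝ) (γ : ℝ)
    (w p q : A → ℝ) (ξ : A → A → O → ℝ) (s t : ℝ) (M M' : A → O → ℝ) (i : A) :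
    exoObj R γ w p q ξ (s • M + t • M') i
      = s * exoObj R γ w p q ξ M i + t * exoObj R γ w p q ξ M' i := by
  simp only [exoObj, fVal, Pi.add_apply, Pi.smul_apply, smul_eq_mul, Finset.mul_sum, add_mul,
    mul_add, mul_sub, Finset.sum_add_distrib, Finset.sum_sub_distrib]
  simp only [mul_assoc, mul_left_comm _ s, mul_left_comm _ t]
  ring

/-- Minimax theorem for the exploration-by-optimization objective. -/
lemma exists_forall_exoObj_le {A O : Type*} [Fintype A] [Nonempty A] [Fintype O] {R : O → ℝ}
    {𝓜 : Set (A → O → ℝ)} (hne : 𝓜.Nonempty)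
    (hprob : ∀ M ∈ 𝓜, ∀ a, (∀ o, 0 ≤ M a o) ∧ ∑ o, M a o = 1) (hconv : Convex ℝ 𝓜)
    (w : ProbVec A) {γ c c' : ℝ} (hγ : 0 < γ) (hc : c < c')
    (H : ∀ N ∈ weightedFamilies 𝓜, ∃ a b, totalRegret R N a - γ * infoGap w.1 N b ≤ c) :
    ∃ (p q : ProbVec A) (ξ : A → A → O → ℝ), ∀ M ∈ 𝓜, ∀ i,
      exoObj R γ w.1 p.1 q.1 ξ M i ≤ c' := by
  classical
  have hIcc : weightedFamilies 𝓜 ⊆ Set.Icc 0 1 := by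
    rintro _ ⟨ν, M, hM, rfl⟩
    have hν : ∀ i, ν.1 i ≤ 1 := fun i => by
      exact (Finset.single_le_sum (fun i _ => ν.2.1 i) (Finset.mem_univ i)).trans ν.2.2.le
    have hM1 : ∀ i a o, M i a o ≤ 1 := fun i a o => by
      rw [← (hprob _ (hM i) a).2]
      exact Finset.single_le_sum (fun o _ => (hprob _ (hM i) a).1 o) (Finset.mem_univ o)
    exact ⟨fun i a o => mul_nonneg (ν.2.1 i) ((hprob _ (hM i) a).1 o),
      fun i a o => mul_le_one₀ (hν i) ((hprob _ (hM i) a).1 o) (hM1 i a o)⟩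
  have hcl : closure (weightedFamilies 𝓜) ⊆ Set.Icc 0 1 := closure_minimal hIcc isClosed_Icc
  have hcpt : IsCompact (closure (weightedFamilies 𝓜)) :=
    isCompact_Icc.of_isClosed_subset isClosed_closure hcl
  have hH : ∀ N ∈ closure (weightedFamilies 𝓜), ∃ a b,
      totalRegret R N a - γ * infoGap w.1 N b ≤ c := by
    have hclosed : IsClosed {N : A → A → O → ℝ | ∃ a b,
        totalRegret R N a - γ * infoGap w.1 N b ≤ c} := by
      simp only [Set.ofPred_exists]
      refine isClosed_iUnion_of_finite fun a => isClosed_iUnion_of_finite fun b => ?_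
      refine isClosed_le ?_ continuous_const
      unfold totalRegret infoGap fVal
      fun_prop
    exact fun N hN => closure_minimal (fun N hN => H N hN) hclosed hN
  let pure : A → ProbVec A := fun a => ⟨Pi.single a 1, fun i => by
    rw [Pi.single_apply]; split_ifs <;> norm_num, by simp⟩
  let L : A × A × (A → A → O → ℝ) → (A → A → O → ℝ) → ℝ := fun X N =>
    ∑ i, exoObj R γ w.1 (pure X.1).1 (pure X.2.1).1 X.2.2 (N i) i
  have hLcont : ∀ X, Continuous (L X) := by
    intro X
    simp only [L]
    unfold exoObj fVal
    fun_prop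
  obtain ⟨T, hT⟩ := hcpt.elim_finite_subcover (fun X => {N | L X N < c'})
    (fun X => isOpen_lt (hLcont X) continuous_const) (fun N hN => by
      obtain ⟨a, b, hab⟩ := hH N hN
      obtain ⟨ξ, hξ⟩ := exists_sum_exoObj_lt hγ w (fun i a o => (hcl hN).1 i a o)
        (hab.trans_lt hc)
      exact Set.mem_iUnion.2 ⟨(a, b, ξ), hξ⟩)
  have hsingle : ∀ M ∈ 𝓜, ∀ i, ∃ N ∈ weightedFamilies 𝓜, ∀ X : A × A × (A → A → O → ℝ),
      L X N = exoObj R γ w.1 (pure X.1).1 (pure X.2.1).1 X.2.2 M i := by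
    intro M hM i
    refine ⟨_, ⟨pure i, fun _ => M, fun _ => hM, rfl⟩, fun X => ?_⟩
    have e : ∀ k, exoObj R γ w.1 (pure X.1).1 (pure X.2.1).1 X.2.2
        (fun a o => (pure i).1 k * M a o) k
        = (pure i).1 k * exoObj R γ w.1 (pure X.1).1 (pure X.2.1).1 X.2.2 M k := by
      intro k
      have := exoObj_add_mul R γ w.1 (pure X.1).1 (pure X.2.1).1 X.2.2 ((pure i).1 k) 0 M 0 k
      rw [zero_smul, add_zero, zero_mul, add_zero] at this
      exact this
    simp only [L, e]
    simp [pure, Pi.single_apply]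
  let Φ : (A → A → O → ℝ) → (T → ℝ) := fun N X => L X.1 N
  have hΦconv : Convex ℝ (Φ '' weightedFamilies 𝓜) := by
    rintro _ ⟨N, hN, rfl⟩ _ ⟨N', hN', rfl⟩ s t hs ht hst
    refine ⟨_, convex_weightedFamilies hconv hN hN' hs ht hst, ?_⟩
    ext X
    simp only [Φ, L, Pi.add_apply, Pi.smul_apply, smul_eq_mul, exoObj_add_mul,
      Finset.sum_add_distrib, Finset.mul_sum]
  obtain ⟨M₀, hM₀⟩ := hne
  obtain ⟨N₀, hN₀, -⟩ := hsingle M₀ hM₀ (Classical.arbitrary A)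
  obtain ⟨l, hl, hl1, hle⟩ := exists_weights_sum_le hΦconv ⟨_, N₀, hN₀, rfl⟩ c' (by
    rintro _ ⟨N, hN, rfl⟩
    obtain ⟨X, hXT, hX⟩ := Set.mem_iUnion₂.1 (hT (subset_closure hN))
    exact ⟨⟨X, hXT⟩, le_of_lt hX⟩)
  obtain ⟨p, q, ξ, h⟩ := exists_exoObj_le_sum R hγ w (fun X : T => pure X.1.1)
    (fun X : T => pure X.1.2.1) (fun X : T => X.1.2.2) hl hl1
  refine ⟨p, q, ξ, fun M hM i => (h M (fun a => (hprob M hM a).1) i).trans ?_⟩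
  obtain ⟨N, hN, hNL⟩ := hsingle M hM i
  have := hle _ ⟨N, hN, rfl⟩
  simpa only [Φ, hNL] using this

lemma ciSup_mem_Icc_of_forall {ι : Type*} [Nonempty ι] {f : ι → ℝ} {a b : ℝ}
    (h : ∀ i, f i ∈ Set.Icc a b) : ⨆ i, f i ∈ Set.Icc a b :=
  ⟨(h (Classical.arbitrary ι)).1.trans
    (le_ciSup ⟨b, Set.forall_mem_range.2 fun i => (h i).2⟩ _), ciSup_le fun i => (h i).2⟩

lemma ciInf_mem_Icc_of_forall {ι : Type*} [Nonempty ι] {f : ι → ℝ} {a b : ℝ}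
    (h : ∀ i, f i ∈ Set.Icc a b) : ⨅ i, f i ∈ Set.Icc a b :=
  ⟨le_ciInf fun i => (h i).1, (ciInf_le ⟨a, Set.forall_mem_range.2 fun i => (h i).1⟩ _).trans
    (h (Classical.arbitrary ι)).2⟩

lemma le_iSup_of_forall_of_nonpos {ι : Type*} [Nonempty ι] {f : ι → ℝ} {a : ℝ} (ha : a ≤ 0)
    (h : ∀ i, a ≤ f i) : a ≤ ⨆ i, f i := by
  by_cases hb : BddAbove (Set.range f)
  · exact (h (Classical.arbitrary ι)).trans (le_ciSup hb _)
  · rwa [Real.iSup_of_not_bddAbove hb]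

lemma sum_mul_le_of_le {A : Type*} [Fintype A] {p f : A → ℝ} {b : ℝ} (hp : ∀ i, 0 ≤ p i)
    (hp1 : ∑ i, p i = 1) (h : ∀ i, f i ≤ b) : ∑ i, p i * f i ≤ b :=
  calc ∑ i, p i * f i ≤ ∑ i, p i * b :=
        Finset.sum_le_sum fun i _ => mul_le_mul_of_nonneg_left (h i) (hp i)
    _ = b := by rw [← Finset.sum_mul, hp1, one_mul]

lemma sum_mul_mem_Icc {A : Type*} [Fintype A] {p f : A → ℝ} {a b : ℝ} (hp : ∀ i, 0 ≤ p i)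
    (hp1 : ∑ i, p i = 1) (h : ∀ i, f i ∈ Set.Icc a b) : ∑ i, p i * f i ∈ Set.Icc a b := by
  refine ⟨?_, sum_mul_le_of_le hp hp1 fun i => (h i).2⟩
  have := sum_mul_le_of_le hp hp1 fun i => neg_le_neg (h i).1
  simp only [mul_neg, Finset.sum_neg_distrib] at this
  linarith

lemma sqHellingerFin_mem_Icc {O : Type*} [Fintype O] {P Q : O → ℝ} (hP : ∀ o, 0 ≤ P o)
    (hP1 : ∑ o, P o = 1) (hQ : ∀ o, 0 ≤ Q o) (hQ1 : ∑ o, Q o = 1) :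
    sqHellingerFin P Q ∈ Set.Icc 0 1 := by
  refine ⟨mul_nonneg (by norm_num) (Finset.sum_nonneg fun o _ => sq_nonneg _), ?_⟩
  have : ∑ o, (√(P o) - √(Q o)) ^ 2 ≤ ∑ o, (P o + Q o) := by
    refine Finset.sum_le_sum fun o _ => ?_
    rw [sub_sq, Real.sq_sqrt (hP o), Real.sq_sqrt (hQ o)]
    nlinarith [mul_nonneg (Real.sqrt_nonneg (P o)) (Real.sqrt_nonneg (Q o))]
  rw [Finset.sum_add_distrib, hP1, hQ1] at this
  rw [sqHellingerFin]; linarith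

lemma neg_one_sub_le_exoObj {A O : Type*} [Fintype A] [Fintype O] {R : O → ℝ}
    (hR : ∀ o, R o ∈ Set.Icc (0 : ℝ) 1) {γ : ℝ} (hγ : 0 < γ) (w p q : ProbVec A)
    (ξ : A → A → O → ℝ) {M : A → O → ℝ}
    (hM : ∀ a, (∀ o, 0 ≤ M a o) ∧ ∑ o, M a o = 1) (i : A) :
    -1 - γ ≤ exoObj R γ w.1 p.1 q.1 ξ M i := by
  have hf : ∀ a, fVal R M a ∈ Set.Icc (0 : ℝ) 1 := fun a => sum_mul_mem_Icc (hM a).1 (hM a).2 hR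
  have h1 := (sum_mul_mem_Icc (a := -1) (b := 1) p.2.1 p.2.2 fun a =>
    (⟨by linarith [(hf i).1, (hf a).2], by linarith [(hf i).2, (hf a).1]⟩ :
      fVal R M i - fVal R M a ∈ Set.Icc (-1 : ℝ) 1)).1
  have h2 : ∑ a, q.1 a * ∑ o, M a o * ∑ k, w.1 k * (1 - Real.exp (ξ k a o - ξ i a o)) ≤ 1 := by
    exact sum_mul_le_of_le q.2.1 q.2.2 fun a => sum_mul_le_of_le (hM a).1 (hM a).2 fun o =>
      sum_mul_le_of_le w.2.1 w.2.2 fun k => by linarith [Real.exp_pos (ξ k a o - ξ i a o)]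
  rw [exoObj]
  nlinarith

/-- Exploration-by-optimization upper bound (Foster et al. 2022): for a nonempty convex
model class `𝓜`, the minimax exploration-by-optimization objective is at most the offset
decision-estimation coefficient `p-dec_{γ/8}(𝓜)`. -/
theorem exo_le_pdec {A O : Type*} [Fintype A] [Nonempty A] [Fintype O] [Nonempty O]
    (R : O → ℝ) (hR : ∀ o, R o ∈ Set.Icc (0 : ℝ) 1)
    (𝓜 : Set (A → O → ℝ)) (h𝓜ne : 𝓜.Nonempty)
    (h𝓜prob : ∀ M ∈ 𝓜, ∀ a, (∀ o, 0 ≤ M a o) ∧ ∑ o, M a o = 1)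
    (h𝓜conv : ∀ M ∈ 𝓜, ∀ M' ∈ 𝓜, ∀ t : ℝ, 0 ≤ t → t ≤ 1 →
      (fun a o => t * M a o + (1 - t) * M' a o) ∈ 𝓜)
    (w : ProbVec A) (γ : ℝ) (hγ : 0 < γ) :
    (⨅ p : ProbVec A, ⨅ q : ProbVec A, ⨅ ξ : A → A → O → ℝ,
        ⨆ M : 𝓜, ⨆ astar : A, exoObj R γ w.1 p.1 q.1 ξ M.1 astar)
      ≤ ⨆ Mbar : 𝓜, ⨅ p : ProbVec A, ⨅ q : ProbVec A,
          ⨆ M : 𝓜,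
            ((∑ a, p.1 a * ((⨆ a' : A, fVal R M.1 a') - fVal R M.1 a))
              - (γ / 8) * ∑ a, q.1 a * sqHellingerFin (M.1 a) (Mbar.1 a)) := by
  have : Nonempty 𝓜 := h𝓜ne.to_subtype
  have : Nonempty (ProbVec A) := ⟨w⟩
  have hconv := convex_of_mix_mem h𝓜conv
  have hf : ∀ M ∈ 𝓜, ∀ a, fVal R M a ∈ Set.Icc (0 : ℝ) 1 := fun M hM a =>
    sum_mul_mem_Icc (h𝓜prob M hM a).1 (h𝓜prob M hM a).2 hR
  have hbound : ∀ (Mbar : 𝓜) (p q : ProbVec A) (M : 𝓜),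
      (∑ a, p.1 a * ((⨆ a' : A, fVal R M.1 a') - fVal R M.1 a))
        - (γ / 8) * ∑ a, q.1 a * sqHellingerFin (M.1 a) (Mbar.1 a)
        ∈ Set.Icc (-1 - γ) (1 + γ) := by
    intro Mbar p q M
    have hs := ciSup_mem_Icc_of_forall (hf M.1 M.2)
    have h1 := sum_mul_mem_Icc (a := -1) (b := 1) p.2.1 p.2.2 fun a =>
      (⟨by linarith [hs.1, (hf M.1 M.2 a).2], by linarith [hs.2, (hf M.1 M.2 a).1]⟩ :
        (⨆ a' : A, fVal R M.1 a') - fVal R M.1 a ∈ Set.Icc (-1 : ℝ) 1)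
    have h2 := sum_mul_mem_Icc q.2.1 q.2.2 fun a => sqHellingerFin_mem_Icc
      (h𝓜prob M.1 M.2 a).1 (h𝓜prob M.1 M.2 a).2 (h𝓜prob Mbar.1 Mbar.2 a).1
      (h𝓜prob Mbar.1 Mbar.2 a).2
    constructor <;> nlinarith [h1.1, h1.2, h2.1, h2.2]
  refine le_of_forall_gt_imp_ge_of_dense fun c' hc' => ?_
  obtain ⟨c, hVc, hcc'⟩ := exists_between hc'
  have hlow : ∀ (p q : ProbVec A) (ξ : A → A → O → ℝ),
      -1 - γ ≤ ⨆ M : 𝓜, ⨆ astar : A, exoObj R γ w.1 p.1 q.1 ξ M.1 astar := fun p q ξ =>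
    le_iSup_of_forall_of_nonpos (by linarith) fun M =>
      le_iSup_of_forall_of_nonpos (by linarith) fun i =>
        neg_one_sub_le_exoObj hR hγ w p q ξ (h𝓜prob M.1 M.2) i
  obtain ⟨p, q, ξ, h⟩ := exists_forall_exoObj_le h𝓜ne h𝓜prob hconv w hγ hcc' (R := R) (by
    rintro _ ⟨ν, M, hM, rfl⟩
    have hmem : (fun a o => ∑ k, ν.1 k * M k a o) ∈ 𝓜 := by
      have h := hconv.sum_mem (t := Finset.univ) (fun i _ => ν.2.1 i) ν.2.2 (fun i _ => hM i)
      convert h using 1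
      ext a o
      simp [Finset.sum_apply]
    have hlt := (le_ciSup (f := fun Mbar : 𝓜 => ⨅ p : ProbVec A, ⨅ q : ProbVec A, ⨆ M : 𝓜,
      ((∑ a, p.1 a * ((⨆ a' : A, fVal R M.1 a') - fVal R M.1 a))
        - (γ / 8) * ∑ a, q.1 a * sqHellingerFin (M.1 a) (Mbar.1 a)))
      ⟨1 + γ, Set.forall_mem_range.2 fun Mbar => (ciInf_mem_Icc_of_forall fun p =>
        ciInf_mem_Icc_of_forall fun q => ciSup_mem_Icc_of_forall (hbound Mbar p q)).2⟩
      ⟨_, hmem⟩).trans_lt hVc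
    obtain ⟨p, hp⟩ := exists_lt_of_ciInf_lt hlt
    obtain ⟨q, hq⟩ := exists_lt_of_ciInf_lt hp
    refine exists_totalRegret_sub_infoGap_le hγ w p q ν (fun i => h𝓜prob _ (hM i)) fun i => ?_
    have h1 := (le_ciSup ⟨1 + γ, Set.forall_mem_range.2 fun M => (hbound ⟨_, hmem⟩ p q M).2⟩
      (⟨M i, hM i⟩ : 𝓜)).trans hq.le
    refine le_trans (sub_le_sub_right (Finset.sum_le_sum fun a _ =>
      mul_le_mul_of_nonneg_left (sub_le_sub_right ?_ _) (p.2.1 a)) _) h1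
    exact le_ciSup (f := fVal R (M i)) (Set.finite_range _).bddAbove i)
  refine (ciInf_le ⟨-1 - γ, Set.forall_mem_range.2 fun p => le_ciInf fun q => le_ciInf (hlow p q)⟩
    p).trans ((ciInf_le ⟨-1 - γ, Set.forall_mem_range.2 fun q => le_ciInf (hlow p q)⟩ q).trans
    ((ciInf_le ⟨-1 - γ, Set.forall_mem_range.2 (hlow p q)⟩ ξ).trans ?_))
  exact ciSup_le fun M => ciSup_le fun i => h M.1 M.2 i
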